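/- There exists an absolute constant C > 0 such that for every n and all α, ε ∈ (0,1), there exists an (α, ε, 0.3)-augmented closeness tester for distributions over [n] whose expected number of samples (drawn from p and q combined) is at most C·(n^{2/3}·α^{1/3}/ε^{4/3} + √n/ε²). -/

import Mathlib

open Finset

/-- The three possible outputs of an augmented tester. -/
inductive Outcome where
  | accept
  | reject
  | inaccurate
deriving DecidableEq

instance : Fintype Outcome where
  elems := {Outcome.accept, Outcome.reject, Outcome.inaccurate}
  complete := by intro x; cases x <;> simp

/-- `p` is a probability distribution on `Fin n`. -/
def IsDist {n : ℕ} (p : Fin n → ℝ) : Prop :=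
  (∀ i, 0 ≤ p i) ∧ ∑ i, p i = 1

/-- Total variation distance `(1/2)·Σᵢ |pᵢ − qᵢ|`. -/
noncomputable def tv {n : ℕ} (p q : Fin n → ℝ) : ℝ :=
  (∑ i, |p i - q i|) / 2

/-- Probability that the randomized algorithm `A`, fed `s` i.i.d. samples from `p`
and `s` i.i.d. samples from `q`, outputs outcome `o`. -/
noncomputable def outProb2 {n s : ℕ} (p q : Fin n → ℝ)
    (A : (Fin s → Fin n) → (Fin s → Fin n) → Outcome → ℝ) (o : Outcome) : ℝ :=
  ∑ x : Fin s → Fin n, ∑ y : Fin s → Fin n,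
    (∏ j, p (x j)) * (∏ j, q (y j)) * A x y o

/-- `A` (which takes the description of the prediction `phat` as input, together
with `s` samples from each of the two unknown distributions `p` and `q`) is an
`(α, ε, δ)`-augmented closeness tester: for every prediction `phat` and every pair
of distributions `p, q` on `Fin n`, (i) if `tv(phat − p) ≤ α` it outputs
`inaccurate` with probability at most `δ/2`; (ii) if `p = q` it outputs `reject`
with probability at most `δ/2`; (iii) if `tv(p − q) > ε` it outputs `accept` with
probability at most `δ/2`. -/
def IsAugClosenessTester {n s : ℕ} (α ε δ : ℝ)
    (A : (Fin n → ℝ) → (Fin s → Fin n) → (Fin s → Fin n) → Outcome → ℝ) : Prop :=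
  (∀ phat x y o, 0 ≤ A phat x y o) ∧ (∀ phat x y, ∑ o, A phat x y o = 1) ∧
  ∀ phat p q : Fin n → ℝ, IsDist phat → IsDist p → IsDist q →
    (tv phat p ≤ α → outProb2 p q (A phat) Outcome.inaccurate ≤ δ / 2) ∧
    (p = q → outProb2 p q (A phat) Outcome.reject ≤ δ / 2) ∧
    (ε < tv p q → outProb2 p q (A phat) Outcome.accept ≤ δ / 2)


/-- The sum of `f` weighted by `r`: the expectation of `f` when `r` is a distribution. -/
noncomputable def wmean {Z : Type*} [Fintype Z] (r f : Z → ℝ) : ℝ := ∑ z, r z * f z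

/-- The product weight of `m` independent draws from `r`. -/
noncomputable def iid {Z : Type*} (r : Z → ℝ) (m : ℕ) (x : Fin m → Z) : ℝ := ∏ j, r (x j)

theorem iid_nonneg {Z : Type*} {r : Z → ℝ} (hr : ∀ z, 0 ≤ r z) (m : ℕ) (x : Fin m → Z) :
    0 ≤ iid r m x :=
  prod_nonneg fun _ _ => hr _

section WeightedMean

variable {Z : Type*} [Fintype Z] {r : Z → ℝ}

theorem wmean_add (f g : Z → ℝ) :
    wmean r (fun z => f z + g z) = wmean r f + wmean r g := by
  simp [wmean, mul_add, sum_add_distrib]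

theorem wmean_sub (f g : Z → ℝ) :
    wmean r (fun z => f z - g z) = wmean r f - wmean r g := by
  simp [wmean, mul_sub]

theorem wmean_mul_left (c : ℝ) (f : Z → ℝ) :
    wmean r (fun z => c * f z) = c * wmean r f := by
  simp only [wmean, mul_sum]
  exact sum_congr rfl fun z _ => by ring

theorem wmean_mul_right (c : ℝ) (f : Z → ℝ) :
    wmean r (fun z => f z * c) = wmean r f * c := by
  simp only [wmean, sum_mul]
  exact sum_congr rfl fun z _ => by ring

theorem wmean_sum {ι : Type*} (s : Finset ι) (f : ι → Z → ℝ) :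
    wmean r (fun z => ∑ i ∈ s, f i z) = ∑ i ∈ s, wmean r (f i) := by
  simp only [wmean, mul_sum]
  exact sum_comm

theorem wmean_const (hr : ∑ z, r z = 1) (c : ℝ) : wmean r (fun _ => c) = c := by
  simp [wmean, ← sum_mul, hr]

theorem wmean_mono (hr : ∀ z, 0 ≤ r z) {f g : Z → ℝ} (h : ∀ z, f z ≤ g z) :
    wmean r f ≤ wmean r g :=
  sum_le_sum fun z _ => mul_le_mul_of_nonneg_left (h z) (hr z)

theorem wmean_nonneg (hr : ∀ z, 0 ≤ r z) {f : Z → ℝ} (h : ∀ z, 0 ≤ f z) :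
    0 ≤ wmean r f :=
  sum_nonneg fun z _ => mul_nonneg (hr z) (h z)

theorem sum_pi_prod {m : ℕ} (g : Fin m → Z → ℝ) :
    ∑ x : Fin m → Z, ∏ j, g j (x j) = ∏ j, ∑ z, g j z := by
  classical
  rw [prod_univ_sum, Fintype.piFinset_univ]

theorem sum_iid (hr : ∑ z, r z = 1) (m : ℕ) : ∑ x, iid r m x = 1 := by
  simp only [iid]
  rw [sum_pi_prod fun _ => r]
  simp [hr]

theorem wmean_iid_apply (hr : ∑ z, r z = 1) {m : ℕ} (f : Z → ℝ) (j : Fin m) :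
    wmean (iid r m) (fun x => f (x j)) = wmean r f := by
  classical
  have h : ∀ x : Fin m → Z, iid r m x * f (x j)
      = ∏ i, r (x i) * (if i = j then f (x i) else 1) := by
    intro x
    rw [prod_mul_distrib, iid]
    congr 1
    simp
  simp only [wmean, h]
  rw [sum_pi_prod fun i z => r z * (if i = j then f z else 1), prod_eq_single j]
  · simp
  · intro i _ hi
    simp [hi, hr]
  · simp

theorem wmean_iid_apply_mul (hr : ∑ z, r z = 1) {m : ℕ} (f g : Z → ℝ) {j k : Fin m}
    (hjk : j ≠ k) :
    wmean (iid r m) (fun x => f (x j) * g (x k)) = wmean r f * wmean r g := by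
  classical
  have h : ∀ x : Fin m → Z, iid r m x * (f (x j) * g (x k))
      = ∏ i, r (x i) * ((if i = j then f (x i) else 1) * (if i = k then g (x i) else 1)) := by
    intro x
    rw [prod_mul_distrib, prod_mul_distrib, iid]
    congr 1
    simp
  simp only [wmean, h]
  rw [sum_pi_prod fun i z => r z * ((if i = j then f z else 1) * (if i = k then g z else 1)),
    prod_eq_mul j k hjk]
  · simp [hjk, hjk.symm]
  · rintro i _ ⟨h₁, h₂⟩
    simp [h₁, h₂, hr]
  · simp
  · simp

theorem wmean_iid_sum (hr : ∑ z, r z = 1) (m : ℕ) (f : Z → ℝ) :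
    wmean (iid r m) (fun x => ∑ j, f (x j)) = m * wmean r f := by
  rw [wmean_sum]
  simp [wmean_iid_apply hr f]

theorem wmean_iid_sum_mul_sum (hr : ∑ z, r z = 1) (m : ℕ) (f g : Z → ℝ) :
    wmean (iid r m) (fun x => (∑ j, f (x j)) * ∑ k, g (x k))
      = m * (m - 1) * (wmean r f * wmean r g) + m * wmean r (fun z => f z * g z) := by
  have h : ∀ j k : Fin m, wmean (iid r m) (fun x => f (x j) * g (x k))
      = wmean r f * wmean r g
        + if j = k then wmean r (fun z => f z * g z) - wmean r f * wmean r g else 0 := by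
    intro j k
    split_ifs with hjk
    · subst hjk
      rw [wmean_iid_apply hr (fun z => f z * g z) j]
      ring
    · rw [wmean_iid_apply_mul hr f g hjk, add_zero]
  simp only [sum_mul_sum, wmean_sum, h, sum_add_distrib]
  simp
  ring

theorem wmean_iid_add (a b : ℕ) (H : (Fin (a + b) → Z) → ℝ) :
    wmean (iid r (a + b)) H
      = wmean (iid r a) fun u => wmean (iid r b) fun v => H (Fin.append u v) := by
  simp only [wmean, mul_sum]
  rw [← (Fin.appendEquiv a b).sum_comp, Fintype.sum_prod_type]
  refine sum_congr rfl fun u _ => sum_congr rfl fun v _ => ?_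
  simp [iid, Fin.prod_univ_add, Fin.appendEquiv, mul_assoc]

/-- The bilinear statistic `∑ a, w a * (∑ j, f a (u j)) * (∑ k, f a (v k))` of two samples. -/
noncomputable def bilinStat {n m : ℕ} (w : Fin n → ℝ) (f : Fin n → Z → ℝ)
    (u v : Fin m → Z) : ℝ :=
  ∑ a, w a * ((∑ j, f a (u j)) * ∑ k, f a (v k))

/-- Bound on the second central moment of the bilinear statistic. -/
theorem wmean_bilinStat_sub_sq_le (hr₀ : ∀ z, 0 ≤ r z) (hr : ∑ z, r z = 1) {n : ℕ} (m : ℕ)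
    (w : Fin n → ℝ) (f : Fin n → Z → ℝ) :
    wmean (iid r m) (fun u => wmean (iid r m) fun v =>
        (bilinStat w f u v - m ^ 2 * ∑ a, w a * wmean r (f a) ^ 2) ^ 2)
      ≤ 2 * m ^ 3 * wmean r (fun z => (∑ a, w a * wmean r (f a) * f a z) ^ 2)
        + m ^ 2 * ∑ a, ∑ b, w a * w b * wmean r (fun z => f a z * f b z) ^ 2 := by
  set θ := ∑ a, w a * wmean r (f a) ^ 2 with hθ
  set ζ := wmean r (fun z => (∑ a, w a * wmean r (f a) * f a z) ^ 2) with hζ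
  set η := ∑ a, ∑ b, w a * w b * wmean r (fun z => f a z * f b z) ^ 2 with hη
  have hζ' : ζ = ∑ a, ∑ b, w a * w b * (wmean r (f a) * wmean r (f b))
      * wmean r (fun z => f a z * f b z) := by
    rw [hζ]
    simp only [sq, sum_mul_sum, wmean_sum]
    refine sum_congr rfl fun a _ => sum_congr rfl fun b _ => ?_
    rw [← wmean_mul_left (w a * w b * (wmean r (f a) * wmean r (f b)))
      fun z => f a z * f b z]
    exact congrArg (wmean r) (funext fun z => by ring)
  have hζ₀ : 0 ≤ ζ := wmean_nonneg hr₀ fun z => sq_nonneg _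
  have hθ' : θ ^ 2 = ∑ a, ∑ b, w a * w b * (wmean r (f a) * wmean r (f b)) ^ 2 := by
    rw [hθ, sq, sum_mul_sum]
    exact sum_congr rfl fun a _ => sum_congr rfl fun b _ => by ring
  have hI := sum_iid hr m
  have h₁ : wmean (iid r m) (fun u => wmean (iid r m) fun v => bilinStat w f u v)
      = m ^ 2 * θ := by
    simp only [bilinStat, wmean_sum, wmean_mul_left, wmean_mul_right, wmean_iid_sum hr]
    rw [hθ, mul_sum]
    exact sum_congr rfl fun a _ => by ring
  have h₂ : wmean (iid r m) (fun u => wmean (iid r m) fun v => bilinStat w f u v ^ 2)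
      = (m * (m - 1)) ^ 2 * θ ^ 2 + 2 * (m ^ 2 * (m - 1)) * ζ + m ^ 2 * η := by
    have e : ∀ u v : Fin m → Z, bilinStat w f u v ^ 2 = ∑ a, ∑ b, w a * w b *
        (((∑ j, f a (u j)) * ∑ j, f b (u j)) * ((∑ j, f a (v j)) * ∑ j, f b (v j))) := by
      intro u v
      rw [bilinStat, sq, sum_mul_sum]
      exact sum_congr rfl fun a _ => sum_congr rfl fun b _ => by ring
    simp only [e, wmean_sum, wmean_mul_left, wmean_mul_right, wmean_iid_sum_mul_sum hr]
    rw [hθ', hζ', hη]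
    simp only [mul_sum, ← sum_add_distrib]
    exact sum_congr rfl fun a _ => sum_congr rfl fun b _ => by ring
  have h₃ : wmean (iid r m) (fun u => wmean (iid r m) fun v =>
        (bilinStat w f u v - m ^ 2 * θ) ^ 2)
      = (m * (m - 1)) ^ 2 * θ ^ 2 + 2 * (m ^ 2 * (m - 1)) * ζ + m ^ 2 * η
        - (m ^ 2 * θ) ^ 2 := by
    have e : ∀ u v : Fin m → Z, (bilinStat w f u v - m ^ 2 * θ) ^ 2
        = bilinStat w f u v ^ 2 - 2 * (m ^ 2 * θ) * bilinStat w f u v + (m ^ 2 * θ) ^ 2 := by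
      intro u v
      ring
    simp only [e, wmean_add, wmean_sub, wmean_mul_left, wmean_const hI, h₁, h₂]
    ring
  rw [h₃]
  rcases Nat.eq_zero_or_pos m with rfl | hm
  · simp
  have hm' : (1 : ℝ) ≤ m := by exact_mod_cast hm
  have k₁ : 0 ≤ (m : ℝ) ^ 2 * ζ := by positivity
  have k₂ : 0 ≤ (m : ℝ) ^ 2 * θ ^ 2 * (2 * m - 1) := by
    have : (0 : ℝ) ≤ 2 * m - 1 := by linarith
    positivity
  nlinarith

end WeightedMean

/-- The law of a pair of independent draws from `p` and `q`. -/
def pairLaw {n : ℕ} (p q : Fin n → ℝ) (z : Fin n × Fin n) : ℝ := p z.1 * q z.2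

/-- The indicator of the event that the first sample equals `a`. -/
noncomputable def fstInd {n : ℕ} (a : Fin n) (z : Fin n × Fin n) : ℝ := if z.1 = a then 1 else 0

/-- The difference of the indicators that the first and the second sample equal `a`. -/
noncomputable def diffInd {n : ℕ} (a : Fin n) (z : Fin n × Fin n) : ℝ :=
  (if z.1 = a then 1 else 0) - if z.2 = a then 1 else 0

section Pair

variable {n : ℕ} {p q : Fin n → ℝ}

theorem pairLaw_nonneg (hp : IsDist p) (hq : IsDist q) (z : Fin n × Fin n) :
    0 ≤ pairLaw p q z :=
  mul_nonneg (hp.1 _) (hq.1 _)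

theorem wmean_pairLaw_mul (g h : Fin n → ℝ) :
    wmean (pairLaw p q) (fun z => g z.1 * h z.2) = (∑ a, p a * g a) * ∑ a, q a * h a := by
  simp only [wmean, pairLaw, Fintype.sum_prod_type, sum_mul_sum]
  exact sum_congr rfl fun a _ => sum_congr rfl fun b _ => by ring

theorem sum_pairLaw (hp : IsDist p) (hq : IsDist q) : ∑ z, pairLaw p q z = 1 := by
  simpa [wmean, hp.2, hq.2] using wmean_pairLaw_mul (p := p) (q := q) (fun _ => 1) fun _ => 1

theorem wmean_pairLaw_fst (hq : IsDist q) (g : Fin n → ℝ) :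
    wmean (pairLaw p q) (fun z => g z.1) = ∑ a, p a * g a := by
  simpa [hq.2] using wmean_pairLaw_mul (p := p) (q := q) g fun _ => 1

theorem wmean_pairLaw_snd (hp : IsDist p) (g : Fin n → ℝ) :
    wmean (pairLaw p q) (fun z => g z.2) = ∑ a, q a * g a := by
  simpa [hp.2] using wmean_pairLaw_mul (p := p) (q := q) (fun _ => 1) g

theorem wmean_fstInd (hq : IsDist q) (a : Fin n) : wmean (pairLaw p q) (fstInd a) = p a :=
  (wmean_pairLaw_fst hq fun x => if x = a then 1 else 0).trans (by simp)

theorem wmean_fstInd_mul (hq : IsDist q) (a b : Fin n) :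
    wmean (pairLaw p q) (fun z => fstInd a z * fstInd b z) = if a = b then p a else 0 := by
  refine (wmean_pairLaw_fst hq
    fun x => (if x = a then (1 : ℝ) else 0) * if x = b then 1 else 0).trans ?_
  by_cases h : a = b <;> simp [h, Ne.symm]

theorem wmean_diffInd (hp : IsDist p) (hq : IsDist q) (a : Fin n) :
    wmean (pairLaw p q) (diffInd a) = p a - q a := by
  have h₁ := wmean_pairLaw_fst (p := p) hq fun x => if x = a then 1 else 0
  have h₂ := wmean_pairLaw_snd (q := q) hp fun x => if x = a then 1 else 0
  change wmean (pairLaw p q) (fun z => _ - _) = _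
  rw [wmean_sub, h₁, h₂]
  simp

theorem wmean_diffInd_mul (hp : IsDist p) (hq : IsDist q) (a b : Fin n) :
    wmean (pairLaw p q) (fun z => diffInd a z * diffInd b z)
      = (if a = b then p a + q a else 0) - (p a * q b + p b * q a) := by
  set I : Fin n → Fin n → ℝ := fun a x => if x = a then 1 else 0 with hI
  have e : ∀ z : Fin n × Fin n, diffInd a z * diffInd b z
      = (I a z.1 * I b z.1 + I a z.2 * I b z.2) - (I a z.1 * I b z.2 + I b z.1 * I a z.2) := by
    intro z
    simp only [diffInd, hI]
    ring
  simp only [e]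
  rw [wmean_sub, wmean_add, wmean_add, wmean_pairLaw_mul, wmean_pairLaw_mul,
    wmean_pairLaw_fst hq fun x => I a x * I b x, wmean_pairLaw_snd hp fun x => I a x * I b x]
  by_cases h : a = b
  · simp [hI, h]
  · simp [hI, h, Ne.symm h]

variable {w : Fin n → ℝ}

theorem mul_le_sqrt_sum (hw : ∀ a, 0 ≤ w a ∧ w a ≤ 1) (p : Fin n → ℝ) (a : Fin n) :
    w a * p a ≤ √(∑ a, w a * p a ^ 2) := by
  apply Real.le_sqrt_of_sq_le
  have h : w a * p a ^ 2 ≤ ∑ a, w a * p a ^ 2 :=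
    single_le_sum (f := fun a => w a * p a ^ 2)
      (fun b _ => mul_nonneg (hw b).1 (sq_nonneg _)) (mem_univ a)
  have := mul_nonneg (mul_nonneg (hw a).1 (sub_nonneg.2 (hw a).2)) (sq_nonneg (p a))
  nlinarith

theorem mul_abs_le_sqrt_sum (hw : ∀ a, 0 ≤ w a ∧ w a ≤ 1) (d : Fin n → ℝ) (a : Fin n) :
    w a * |d a| ≤ √(∑ a, w a * d a ^ 2) := by
  simpa using mul_le_sqrt_sum hw (fun a => |d a|) a

/-- Second central moment of the estimator of the weighted squared norm. -/
theorem wmean_fstInd_stat_le (hp : IsDist p) (hq : IsDist q)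
    (hw : ∀ a, 0 ≤ w a ∧ w a ≤ 1) (m : ℕ) :
    wmean (iid (pairLaw p q) m) (fun u => wmean (iid (pairLaw p q) m) fun v =>
        (bilinStat w fstInd u v - m ^ 2 * ∑ a, w a * p a ^ 2) ^ 2)
      ≤ 2 * m ^ 3 * √(∑ a, w a * p a ^ 2) ^ 3 + m ^ 2 * √(∑ a, w a * p a ^ 2) ^ 2 := by
  set B := ∑ a, w a * p a ^ 2 with hB
  have hB₀ : 0 ≤ B := sum_nonneg fun a _ => mul_nonneg (hw a).1 (sq_nonneg _)
  have hs : √B ^ 2 = B := Real.sq_sqrt hB₀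
  have key := wmean_bilinStat_sub_sq_le (pairLaw_nonneg hp hq) (sum_pairLaw hp hq) m w fstInd
  simp only [wmean_fstInd hq, wmean_fstInd_mul hq] at key
  refine key.trans ?_
  gcongr ?_ + ?_
  · rw [mul_assoc, mul_assoc]
    gcongr
    have e : ∀ z : Fin n × Fin n, (∑ a, w a * p a * fstInd a z) ^ 2 = (w z.1 * p z.1) ^ 2 := by
      intro z
      simp [fstInd]
    simp only [e]
    rw [wmean_pairLaw_fst hq fun x => (w x * p x) ^ 2, pow_succ, hs, hB, sum_mul]
    refine sum_le_sum fun a _ => ?_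
    have := mul_le_mul_of_nonneg_left (mul_le_sqrt_sum hw p a)
      (mul_nonneg (hw a).1 (sq_nonneg (p a)))
    nlinarith
  · gcongr
    rw [hs, hB]
    refine sum_le_sum fun a _ => ?_
    rw [sum_eq_single a (by intro b _ h; simp [h.symm]) (by simp)]
    have := mul_nonneg (mul_nonneg (hw a).1 (sub_nonneg.2 (hw a).2)) (sq_nonneg (p a))
    simp only [if_true]
    nlinarith

/-- Second central moment of the estimator of the weighted squared distance. -/
theorem wmean_diffInd_stat_le (hp : IsDist p) (hq : IsDist q)
    (hw : ∀ a, 0 ≤ w a ∧ w a ≤ 1) (m : ℕ) :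
    wmean (iid (pairLaw p q) m) (fun u => wmean (iid (pairLaw p q) m) fun v =>
        (bilinStat w diffInd u v - m ^ 2 * ∑ a, w a * (p a - q a) ^ 2) ^ 2)
      ≤ 4 * m ^ 3 * ((2 * √(∑ a, w a * p a ^ 2) + √(∑ a, w a * (p a - q a) ^ 2))
          * ∑ a, w a * (p a - q a) ^ 2)
        + 8 * m ^ 2 * (∑ a, w a * p a ^ 2 + ∑ a, w a * q a ^ 2) := by
  set d : Fin n → ℝ := fun a => p a - q a with hd
  set B := ∑ a, w a * p a ^ 2 with hB
  set B' := ∑ a, w a * q a ^ 2 with hB'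
  set D := ∑ a, w a * (p a - q a) ^ 2 with hD
  have norm_le_one : ∀ t : Fin n → ℝ, IsDist t → ∑ a, w a * t a ^ 2 ≤ 1 := by
    intro t ht
    rw [← ht.2]
    refine sum_le_sum fun a _ => ?_
    have h₁ : t a ≤ 1 := ht.2 ▸ single_le_sum (fun b _ => ht.1 b) (mem_univ a)
    have h₂ : t a ^ 2 ≤ t a := by nlinarith [ht.1 a]
    nlinarith [(hw a).1, (hw a).2, sq_nonneg (t a)]
  have hB₀ : 0 ≤ B := sum_nonneg fun a _ => mul_nonneg (hw a).1 (sq_nonneg _)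
  have hB'₀ : 0 ≤ B' := sum_nonneg fun a _ => mul_nonneg (hw a).1 (sq_nonneg _)
  have key := wmean_bilinStat_sub_sq_le (pairLaw_nonneg hp hq) (sum_pairLaw hp hq) m w diffInd
  simp only [wmean_diffInd hp hq, wmean_diffInd_mul hp hq] at key
  refine key.trans ?_
  have hζ : wmean (pairLaw p q) (fun z => (∑ a, w a * (p a - q a) * diffInd a z) ^ 2)
      ≤ 2 * ((2 * √B + √D) * D) := by
    have e : ∀ z : Fin n × Fin n, (∑ a, w a * (p a - q a) * diffInd a z) ^ 2
        ≤ 2 * ((w z.1 * d z.1) ^ 2 + (w z.2 * d z.2) ^ 2) := by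
      intro z
      have : ∑ a, w a * (p a - q a) * diffInd a z = w z.1 * d z.1 - w z.2 * d z.2 := by
        simp [diffInd, mul_sub, hd]
      rw [this]
      nlinarith [sq_nonneg (w z.1 * d z.1 + w z.2 * d z.2)]
    refine (wmean_mono (pairLaw_nonneg hp hq) e).trans ?_
    rw [wmean_mul_left, wmean_add, wmean_pairLaw_fst hq fun x => (w x * d x) ^ 2,
      wmean_pairLaw_snd hp fun x => (w x * d x) ^ 2, ← sum_add_distrib, hD]
    refine mul_le_mul_of_nonneg_left ?_ zero_le_two
    rw [mul_sum]
    refine sum_le_sum fun a _ => ?_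
    have h₁ := mul_le_sqrt_sum hw p a
    have h₂ := mul_abs_le_sqrt_sum hw d a
    have h₃ : w a * (p a + q a) ≤ 2 * √B + √D := by
      have : w a * (p a + q a) ≤ w a * (2 * p a + |d a|) :=
        mul_le_mul_of_nonneg_left (by linarith [neg_abs_le (d a)]) (hw a).1
      linarith
    have h₄ := mul_le_mul_of_nonneg_right h₃ (mul_nonneg (hw a).1 (sq_nonneg (d a)))
    calc _ = w a * (p a + q a) * (w a * d a ^ 2) := by ring
      _ ≤ _ := h₄
  have hη : ∑ a, ∑ b, w a * w b * ((if a = b then p a + q a else 0)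
      - (p a * q b + p b * q a)) ^ 2 ≤ 8 * (B + B') := by
    have e : ∀ a b, w a * w b * ((if a = b then p a + q a else 0)
          - (p a * q b + p b * q a)) ^ 2
        ≤ (if a = b then 4 * (w a * p a ^ 2 + w a * q a ^ 2) else 0)
          + 4 * ((w a * p a ^ 2) * (w b * q b ^ 2) + (w a * q a ^ 2) * (w b * p b ^ 2)) := by
      intro a b
      have hab := mul_nonneg (hw a).1 (hw b).1
      have h₁ : ((if a = b then p a + q a else 0) - (p a * q b + p b * q a)) ^ 2
          ≤ 2 * (if a = b then p a + q a else 0) ^ 2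
            + 4 * ((p a * q b) ^ 2 + (p b * q a) ^ 2) := by
        generalize (if a = b then p a + q a else 0) = x
        nlinarith [sq_nonneg (x + (p a * q b + p b * q a)), sq_nonneg (p a * q b - p b * q a)]
      have h₂ := mul_le_mul_of_nonneg_left h₁ hab
      have h₃ : w a * w b * (2 * (if a = b then p a + q a else 0) ^ 2)
          ≤ if a = b then 4 * (w a * p a ^ 2 + w a * q a ^ 2) else 0 := by
        split_ifs with h
        · subst h
          have h₄ : w a * w a ≤ w a := by nlinarith [(hw a).1, (hw a).2]
          have h₅ := mul_le_mul_of_nonneg_right h₄ (sq_nonneg (p a + q a))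
          nlinarith [mul_nonneg (hw a).1 (sq_nonneg (p a - q a))]
        · simp
      nlinarith
    refine (sum_le_sum fun a _ => sum_le_sum fun b _ => e a b).trans ?_
    have e₂ : ∑ a, ∑ b, ((if a = b then 4 * (w a * p a ^ 2 + w a * q a ^ 2) else 0)
          + 4 * ((w a * p a ^ 2) * (w b * q b ^ 2) + (w a * q a ^ 2) * (w b * p b ^ 2)))
        = 4 * (B + B') + 8 * (B * B') := by
      simp only [sum_add_distrib, ← mul_sum, ← sum_mul, sum_ite_eq, mem_univ, if_true]
      ring
    rw [e₂]
    nlinarith [norm_le_one p hp, norm_le_one q hq]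
  have hm : (0 : ℝ) ≤ m := m.cast_nonneg
  have h₁ := mul_le_mul_of_nonneg_left hζ (by positivity : (0 : ℝ) ≤ 2 * m ^ 3)
  have h₂ := mul_le_mul_of_nonneg_left hη (by positivity : (0 : ℝ) ≤ (m : ℝ) ^ 2)
  linarith

/-- Chebyshev's inequality for a statistic of two independent samples. -/
theorem wmean_indicator_le {Z : Type*} [Fintype Z] {r : Z → ℝ} (hr : ∀ z, 0 ≤ r z)
    (P : Z → Z → Prop) [∀ u v, Decidable (P u v)] (S : Z → Z → ℝ) {c t M : ℝ} (ht : 0 < t)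
    (hP : ∀ u v, P u v → t ≤ |S u v - c|)
    (hM : wmean r (fun u => wmean r fun v => (S u v - c) ^ 2) ≤ M) :
    wmean r (fun u => wmean r fun v => if P u v then 1 else 0) ≤ M / t ^ 2 := by
  rw [le_div_iff₀ (by positivity)]
  refine le_trans ?_ hM
  rw [← wmean_mul_right]
  refine wmean_mono hr fun u => ?_
  rw [← wmean_mul_right]
  refine wmean_mono hr fun v => ?_
  split_ifs with h
  · rw [one_mul, ← sq_abs (S u v - c)]
    have := hP u v h
    gcongr
  · rw [zero_mul]
    positivity

theorem wmean_norm_stat_indicator_le (hp : IsDist p) (hq : IsDist q)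
    (hw : ∀ a, 0 ≤ w a ∧ w a ≤ 1) {m : ℕ} (hm : 1000 ≤ m * √(∑ a, w a * p a ^ 2))
    (P : (Fin m → Fin n × Fin n) → (Fin m → Fin n × Fin n) → Prop)
    [∀ u v, Decidable (P u v)]
    (hP : ∀ u v, P u v → m ^ 2 * (∑ a, w a * p a ^ 2) / 2
      ≤ |bilinStat w fstInd u v - m ^ 2 * ∑ a, w a * p a ^ 2|) :
    wmean (iid (pairLaw p q) m) (fun u => wmean (iid (pairLaw p q) m) fun v =>
      if P u v then 1 else 0) ≤ 0.05 := by
  have hB₀ : 0 ≤ ∑ a, w a * p a ^ 2 :=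
    sum_nonneg fun a _ => mul_nonneg (hw a).1 (sq_nonneg _)
  have hs := Real.sq_sqrt hB₀
  have ht : 0 < m ^ 2 * (∑ a, w a * p a ^ 2) / 2 := by
    rw [← hs, ← mul_pow]
    have : 0 < m * √(∑ a, w a * p a ^ 2) := by linarith
    positivity
  refine (wmean_indicator_le (iid_nonneg (pairLaw_nonneg hp hq) m) P _ ht hP
    (wmean_fstInd_stat_le hp hq hw m)).trans ?_
  rw [div_le_iff₀ (by positivity)]
  set B := ∑ a, w a * p a ^ 2
  set x := m * √B with hx
  have e₁ : 2 * (m : ℝ) ^ 3 * √B ^ 3 + m ^ 2 * √B ^ 2 = x ^ 2 * (2 * x + 1) := by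
    rw [hx]
    ring
  have e₂ : 0.05 * ((m : ℝ) ^ 2 * B / 2) ^ 2 = x ^ 2 * (0.0125 * x ^ 2) := by
    rw [hx, ← hs, Real.sqrt_sq (Real.sqrt_nonneg _)]
    ring
  rw [e₁, e₂]
  gcongr
  nlinarith

end Pair

/-- The flattening weights determined by the prediction and a first batch of samples. -/
noncomputable def flatWeight {n m : ℕ} (phat : Fin n → ℝ) (f : Fin m → Fin n × Fin n)
    (a : Fin n) : ℝ :=
  (1 + n * phat a + n / m * ∑ j, fstInd a (f j))⁻¹

/-- The verdict: compare the norm statistic, then the distance statistic, to a threshold. -/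
noncomputable def verdict {n m : ℕ} (T τ : ℝ) (w : Fin n → ℝ)
    (u v : Fin m → Fin n × Fin n) : Outcome :=
  if m ^ 2 * T < bilinStat w fstInd u v then Outcome.inaccurate
  else if m ^ 2 * τ < bilinStat w diffInd u v then Outcome.reject
  else Outcome.accept

section Flattening

variable {n m : ℕ} {p q phat : Fin n → ℝ}

theorem fstInd_nonneg (a : Fin n) (z : Fin n × Fin n) : 0 ≤ fstInd a z := by
  unfold fstInd
  positivity

theorem one_le_flatWeight_inv (h : IsDist phat) (f : Fin m → Fin n × Fin n) (a : Fin n) :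
    1 ≤ 1 + n * phat a + n / m * ∑ j, fstInd a (f j) := by
  have h₁ : 0 ≤ n * phat a := mul_nonneg n.cast_nonneg (h.1 a)
  have h₂ : 0 ≤ (n : ℝ) / m * ∑ j, fstInd a (f j) :=
    mul_nonneg (by positivity) (sum_nonneg fun j _ => fstInd_nonneg _ _)
  linarith

theorem flatWeight_mem (h : IsDist phat) (f : Fin m → Fin n × Fin n) (a : Fin n) :
    0 ≤ flatWeight phat f a ∧ flatWeight phat f a ≤ 1 := by
  have := one_le_flatWeight_inv h f a
  exact ⟨inv_nonneg.2 (by linarith), inv_le_one_of_one_le₀ this⟩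

theorem sum_flatWeight_inv (hm : 0 < m) (h : IsDist phat) (f : Fin m → Fin n × Fin n) :
    ∑ a, (flatWeight phat f a)⁻¹ = 3 * n := by
  have hm' : (m : ℝ) ≠ 0 := by positivity
  simp only [flatWeight, inv_inv, sum_add_distrib, ← mul_sum, h.2]
  rw [sum_comm]
  simp [fstInd]
  field_simp
  ring

theorem sq_sum_abs_le (hm : 0 < m) (h : IsDist phat) (f : Fin m → Fin n × Fin n)
    (t : Fin n → ℝ) :
    (∑ a, |t a|) ^ 2 ≤ (∑ a, flatWeight phat f a * t a ^ 2) * (3 * n) := by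
  rw [← sum_flatWeight_inv hm h f]
  refine sum_sq_le_sum_mul_sum_of_sq_le_mul _
    (fun a _ => mul_nonneg (flatWeight_mem h f a).1 (sq_nonneg _))
    (fun a _ => inv_nonneg.2 (flatWeight_mem h f a).1) fun a _ => ?_
  have h₁ : flatWeight phat f a ≠ 0 :=
    (inv_pos.2 (by linarith [one_le_flatWeight_inv h f a])).ne'
  rw [sq_abs]
  refine le_of_eq ?_
  field_simp

theorem mul_flatWeight_le (hn : 0 < n) (hm : 0 < m) (hp : IsDist p) (h : IsDist phat)
    (f : Fin m → Fin n × Fin n) (a : Fin n) :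
    p a * flatWeight phat f a
      ≤ 2 / n + 4 / (m ^ 2 * p a) * (∑ j, fstInd a (f j) - m * p a) ^ 2 := by
  have hn' : (0 : ℝ) < n := by exact_mod_cast hn
  have hm' : (0 : ℝ) < m := by exact_mod_cast hm
  have hw := flatWeight_mem h f a
  rcases (hp.1 a).eq_or_lt with h₀ | h₀
  · rw [← h₀]
    simp only [zero_mul, mul_zero, div_zero, add_zero]
    positivity
  set F := ∑ j, fstInd a (f j)
  by_cases hc : m * p a / 2 ≤ F
  · have h₁ : n * p a / 2 ≤ 1 + n * phat a + n / m * F := by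
      have h₂ : n / m * (m * p a / 2) ≤ n / m * F := by gcongr
      have h₃ : n / m * (m * p a / 2) = n * p a / 2 := by field_simp
      have h₄ : 0 ≤ n * phat a := mul_nonneg n.cast_nonneg (h.1 a)
      linarith
    have h₂ : p a * flatWeight phat f a ≤ 2 / n := by
      rw [flatWeight, ← div_eq_mul_inv,
        div_le_div_iff₀ (by linarith [one_le_flatWeight_inv h f a]) hn']
      linarith
    have : 0 ≤ 4 / (m ^ 2 * p a) * (F - m * p a) ^ 2 := by positivity
    linarith
  · push Not at hc
    have h₁ : (m * p a / 2) ^ 2 ≤ (F - m * p a) ^ 2 := by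
      rw [← neg_sq (F - m * p a)]
      have : 0 < m * p a / 2 := by positivity
      gcongr
      linarith
    have h₂ : p a ≤ 4 / (m ^ 2 * p a) * (F - m * p a) ^ 2 := by
      calc p a = 4 / (m ^ 2 * p a) * (m * p a / 2) ^ 2 := by field_simp; norm_num
        _ ≤ _ := by gcongr
    have h₃ : p a * flatWeight phat f a ≤ p a := mul_le_of_le_one_right h₀.le hw.2
    have : (0 : ℝ) ≤ 2 / n := by positivity
    linarith

theorem wmean_count_sub_sq_le (hp : IsDist p) (hq : IsDist q) (a : Fin n) :
    wmean (iid (pairLaw p q) m) (fun f => (∑ j, fstInd a (f j) - m * p a) ^ 2) ≤ m * p a := by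
  have hr := sum_pairLaw hp hq
  have e : ∀ f : Fin m → Fin n × Fin n, (∑ j, fstInd a (f j) - m * p a) ^ 2
      = (∑ j, fstInd a (f j)) * (∑ j, fstInd a (f j)) - 2 * (m * p a) * ∑ j, fstInd a (f j)
        + (m * p a) ^ 2 := by
    intro f
    ring
  simp only [e]
  rw [wmean_add, wmean_sub, wmean_mul_left, wmean_const (sum_iid hr m),
    wmean_iid_sum_mul_sum hr, wmean_iid_sum hr, wmean_fstInd_mul hq, wmean_fstInd hq]
  simp only [if_true]
  nlinarith [mul_nonneg (m.cast_nonneg : (0 : ℝ) ≤ m) (sq_nonneg (p a))]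

/-- Flattening makes the weighted squared norm small when the prediction is accurate. -/
theorem wmean_flat_norm_le (hn : 0 < n) (hm : 0 < m) (hp : IsDist p) (hq : IsDist q)
    (h : IsDist phat) {α : ℝ} (hα : α ≤ 1) (htv : tv phat p ≤ α) :
    wmean (iid (pairLaw p q) m) (fun f => ∑ a, flatWeight phat f a * p a ^ 2)
      ≤ 8 * (1 / n + α / m) := by
  have hn' : (0 : ℝ) < n := by exact_mod_cast hn
  have hm' : (0 : ℝ) < m := by exact_mod_cast hm
  have hr := pairLaw_nonneg hp hq
  have e : ∀ f : Fin m → Fin n × Fin n, ∑ a, flatWeight phat f a * p a ^ 2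
      ≤ ∑ a, (p a / n + |phat a - p a|
        * (2 / n + 4 / (m ^ 2 * p a) * (∑ j, fstInd a (f j) - m * p a) ^ 2)) := by
    intro f
    refine sum_le_sum fun a _ => ?_
    have hw := flatWeight_mem h f a
    have h₁ := mul_flatWeight_le hn hm hp h f a
    have h₂ := mul_le_mul_of_nonneg_left h₁ (abs_nonneg (phat a - p a))
    have h₃ : flatWeight phat f a * phat a ≤ 1 / n := by
      have h₅ := one_le_flatWeight_inv h f a
      rw [flatWeight, ← div_eq_inv_mul, div_le_div_iff₀ (by linarith) hn']
      have h₆ : 0 ≤ (n : ℝ) / m * ∑ j, fstInd a (f j) :=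
        mul_nonneg (by positivity) (sum_nonneg fun j _ => fstInd_nonneg _ _)
      linarith
    have h₄ : flatWeight phat f a * p a ^ 2
        ≤ p a * (flatWeight phat f a * phat a)
          + |phat a - p a| * (p a * flatWeight phat f a) := by
      have := mul_le_mul_of_nonneg_left (neg_abs_le (phat a - p a))
        (mul_nonneg (hp.1 a) hw.1)
      nlinarith
    have h₅ := mul_le_mul_of_nonneg_left h₃ (hp.1 a)
    have h₆ : p a * (1 / n) = p a / n := by ring
    linarith
  refine (wmean_mono (iid_nonneg hr m) e).trans ?_
  simp only [wmean_sum, wmean_add, wmean_mul_left,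
    wmean_const (sum_iid (sum_pairLaw hp hq) m)]
  have e₂ : ∀ a, p a / n + |phat a - p a| * (2 / n + 4 / (m ^ 2 * p a) *
        wmean (iid (pairLaw p q) m) fun f => (∑ j, fstInd a (f j) - m * p a) ^ 2)
      ≤ p a / n + |phat a - p a| * (2 / n + 4 / m) := by
    intro a
    gcongr
    rcases (hp.1 a).eq_or_lt with h₀ | h₀
    · rw [← h₀]
      simp
      positivity
    · calc _ ≤ 4 / (m ^ 2 * p a) * (m * p a) := by
            gcongr
            exact wmean_count_sub_sq_le hp hq a
        _ = 4 / m := by field_simp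
  refine (sum_le_sum fun a _ => e₂ a).trans ?_
  rw [sum_add_distrib, ← sum_mul, ← sum_div, hp.2]
  have h₁ : ∑ a, |phat a - p a| ≤ 2 * α := by
    unfold tv at htv
    linarith
  have h₂ := mul_le_mul_of_nonneg_right h₁ (by positivity : (0 : ℝ) ≤ 2 / n + 4 / m)
  have h₃ : 8 * (1 / n + α / m) - (1 / n + 2 * α * (2 / n + 4 / m))
      = (3 + 4 * (1 - α)) * (1 / n : ℝ) := by
    field_simp
    ring
  have : 0 ≤ (3 + 4 * (1 - α)) * (1 / n : ℝ) :=
    mul_nonneg (by linarith) (by positivity)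
  linarith

end Flattening

section Verdict

variable {n m : ℕ} {p q w : Fin n → ℝ} {T δ : ℝ}

theorem wmean_verdict_inaccurate_le (hp : IsDist p) (hq : IsDist q)
    (hw : ∀ a, 0 ≤ w a ∧ w a ≤ 1) (hm : 1000 ≤ m * √(∑ a, w a * p a ^ 2))
    (hT : 2 * ∑ a, w a * p a ^ 2 ≤ T) :
    wmean (iid (pairLaw p q) m) (fun u => wmean (iid (pairLaw p q) m) fun v =>
      if verdict T δ w u v = Outcome.inaccurate then 1 else 0) ≤ 0.05 := by
  refine wmean_norm_stat_indicator_le hp hq hw hm _ fun u v huv => ?_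
  have h₁ : m ^ 2 * T < bilinStat w fstInd u v := by
    by_contra hc
    unfold verdict at huv
    split_ifs at huv
  have h₂ := mul_le_mul_of_nonneg_left hT (sq_nonneg (m : ℝ))
  have h₃ : 0 ≤ m ^ 2 * ∑ a, w a * p a ^ 2 :=
    mul_nonneg (sq_nonneg _) (sum_nonneg fun a _ => mul_nonneg (hw a).1 (sq_nonneg _))
  refine le_trans ?_ (le_abs_self _)
  linarith

theorem wmean_verdict_ne_inaccurate_le (hp : IsDist p) (hq : IsDist q)
    (hw : ∀ a, 0 ≤ w a ∧ w a ≤ 1) (hm : 1000 ≤ m * √(∑ a, w a * p a ^ 2))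
    (hT : 2 * T ≤ ∑ a, w a * p a ^ 2) {o : Outcome} (ho : o ≠ Outcome.inaccurate) :
    wmean (iid (pairLaw p q) m) (fun u => wmean (iid (pairLaw p q) m) fun v =>
      if verdict T δ w u v = o then 1 else 0) ≤ 0.05 := by
  refine wmean_norm_stat_indicator_le hp hq hw hm _ fun u v huv => ?_
  have h₁ : bilinStat w fstInd u v ≤ m ^ 2 * T := by
    by_contra hc
    rw [verdict, if_pos (not_le.1 hc)] at huv
    exact ho huv.symm
  have h₂ := mul_le_mul_of_nonneg_left hT (sq_nonneg (m : ℝ))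
  refine le_trans ?_ (neg_le_abs _)
  linarith

theorem wmean_verdict_reject_le (hp : IsDist p) (hw : ∀ a, 0 ≤ w a ∧ w a ≤ 1)
    (hm : 1000 ≤ m * √(∑ a, w a * p a ^ 2)) (hδ : 0 < δ)
    (hT : 2000 ^ 2 * (2 * T) ≤ (m * δ) ^ 2) :
    wmean (iid (pairLaw p p) m) (fun u => wmean (iid (pairLaw p p) m) fun v =>
      if verdict T (δ / 2) w u v = Outcome.reject then 1 else 0) ≤ 0.05 := by
  rcases le_total (2 * T) (∑ a, w a * p a ^ 2) with hB | hB
  · exact wmean_verdict_ne_inaccurate_le hp hp hw hm hB (by decide)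
  have hm₀ : 0 < (m : ℝ) := by
    rcases (m.cast_nonneg : (0 : ℝ) ≤ m).eq_or_lt with h | h
    · rw [← h] at hm
      norm_num at hm
    · exact h
  have key := wmean_diffInd_stat_le hp hp hw m
  simp only [sub_self, ne_eq, OfNat.ofNat_ne_zero, not_false_eq_true, zero_pow, mul_zero,
    sum_const_zero, sub_zero, zero_add] at key
  refine (wmean_indicator_le (iid_nonneg (pairLaw_nonneg hp hp) m) _ (bilinStat w diffInd)
    (c := 0) (t := m ^ 2 * (δ / 2)) (by positivity) (fun u v huv => ?_)
    (by simpa only [sub_zero] using key)).trans ?_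
  · rw [sub_zero]
    refine le_trans ?_ (le_abs_self _)
    by_contra hc
    unfold verdict at huv
    split_ifs at huv with h₁ h₂
    exact hc h₂.le
  · rw [div_le_iff₀ (by positivity)]
    have h₁ := mul_le_mul_of_nonneg_left ((mul_le_mul_of_nonneg_left hB
      (by norm_num : (0 : ℝ) ≤ 2000 ^ 2)).trans hT) (sq_nonneg (m : ℝ))
    have h₂ : 0 ≤ (m : ℝ) ^ 2 * (m * δ) ^ 2 := by positivity
    nlinarith

theorem wmean_verdict_accept_le (hp : IsDist p) (hq : IsDist q)
    (hw : ∀ a, 0 ≤ w a ∧ w a ≤ 1) (hm : 1000 ≤ m * √(∑ a, w a * p a ^ 2)) (hδ : 0 < δ)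
    (hT : 2000 ^ 2 * (2 * T) ≤ (m * δ) ^ 2) (hδm : 2000 ^ 2 ≤ m ^ 2 * δ)
    (hD : δ ≤ ∑ a, w a * (p a - q a) ^ 2) :
    wmean (iid (pairLaw p q) m) (fun u => wmean (iid (pairLaw p q) m) fun v =>
      if verdict T (δ / 2) w u v = Outcome.accept then 1 else 0) ≤ 0.05 := by
  rcases le_total (2 * T) (∑ a, w a * p a ^ 2) with hB | hB
  · exact wmean_verdict_ne_inaccurate_le hp hq hw hm hB (by decide)
  have hm₀ : 0 < (m : ℝ) := by
    rcases (m.cast_nonneg : (0 : ℝ) ≤ m).eq_or_lt with h | h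
    · rw [← h] at hm
      norm_num at hm
    · exact h
  have hB' : ∑ a, w a * q a ^ 2
      ≤ 2 * ∑ a, w a * p a ^ 2 + 2 * ∑ a, w a * (p a - q a) ^ 2 := by
    rw [mul_sum, mul_sum, ← sum_add_distrib]
    refine sum_le_sum fun a _ => ?_
    nlinarith [mul_nonneg (hw a).1 (sq_nonneg (2 * p a - q a))]
  have key := wmean_diffInd_stat_le hp hq hw m
  have hB₀ : 0 ≤ ∑ a, w a * p a ^ 2 :=
    sum_nonneg fun a _ => mul_nonneg (hw a).1 (sq_nonneg _)
  set B := ∑ a, w a * p a ^ 2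
  set B' := ∑ a, w a * q a ^ 2
  set D := ∑ a, w a * (p a - q a) ^ 2
  have hD₀ : 0 < D := hδ.trans_le hD
  refine (wmean_indicator_le (iid_nonneg (pairLaw_nonneg hp hq) m) _ (bilinStat w diffInd)
    (t := m ^ 2 * D / 2) (by positivity) (fun u v huv => ?_) key).trans ?_
  · have h₁ : bilinStat w diffInd u v ≤ m ^ 2 * (δ / 2) := by
      by_contra hc
      unfold verdict at huv
      split_ifs at huv with h₁ h₂
      exact hc (not_lt.1 h₂)
    have h₂ := mul_le_mul_of_nonneg_left hD (sq_nonneg (m : ℝ))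
    refine le_trans ?_ (neg_le_abs _)
    linarith
  · rw [div_le_iff₀ (by positivity)]
    have hmD : m * δ ≤ m * D := by gcongr
    have h₁ : 2000 ^ 2 * B ≤ (m * D) ^ 2 := by
      have : (m * δ) ^ 2 ≤ (m * D) ^ 2 := by gcongr
      linarith
    have h₂ : 2000 ^ 2 * D ≤ (m * D) ^ 2 := by
      have : 2000 ^ 2 ≤ m ^ 2 * D := hδm.trans (by gcongr)
      nlinarith
    have h₃ : ∀ x : ℝ, 2000 ^ 2 * x ≤ (m * D) ^ 2 → √x ≤ m * D / 2000 := by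
      intro x hx
      rw [Real.sqrt_le_left (by positivity), div_pow, le_div_iff₀ (by norm_num)]
      linarith
    have h₄ := h₃ B h₁
    have h₅ := h₃ D h₂
    have h₆ : (2 * √B + √D) * D ≤ 3 * (m * D / 2000) * D := by
      gcongr
      linarith
    have h₇ := mul_le_mul_of_nonneg_left h₆ (by positivity : (0 : ℝ) ≤ 4 * m ^ 3)
    have h₈ : B + B' ≤ 5 * ((m * D) ^ 2 / 2000 ^ 2) := by
      have : (m * D) ^ 2 = 2000 ^ 2 * ((m * D) ^ 2 / 2000 ^ 2) := by ring
      linarith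
    have h₉ := mul_le_mul_of_nonneg_left h₈ (by positivity : (0 : ℝ) ≤ 8 * m ^ 2)
    have h₀ : 0 ≤ (m : ℝ) ^ 4 * D ^ 2 := by positivity
    nlinarith

end Verdict

/-- The output distribution of the tester, which is deterministic: the first batch of samples
determines the flattening weights, the other two are fed to the statistics. -/
noncomputable def augTester {n m : ℕ} (T τ : ℝ) (phat : Fin n → ℝ)
    (x y : Fin (m + (m + m)) → Fin n) (o : Outcome) : ℝ :=
  if verdict T τ
      (flatWeight phat fun j : Fin m => (x (Fin.castAdd _ j), y (Fin.castAdd _ j)))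
      (fun j : Fin m => (x (Fin.natAdd _ (Fin.castAdd _ j)), y (Fin.natAdd _ (Fin.castAdd _ j))))
      (fun j : Fin m => (x (Fin.natAdd _ (Fin.natAdd _ j)), y (Fin.natAdd _ (Fin.natAdd _ j))))
    = o then 1 else 0

theorem outProb2_eq_wmean {n s : ℕ} (p q : Fin n → ℝ)
    (A : (Fin s → Fin n) → (Fin s → Fin n) → Outcome → ℝ) (o : Outcome) :
    outProb2 p q A o = wmean (iid (pairLaw p q) s)
      fun z => A (fun j => (z j).1) (fun j => (z j).2) o := by
  rw [outProb2, wmean, ← (Equiv.arrowProdEquivProdArrow (Fin s) (fun _ => Fin n)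
    fun _ => Fin n).symm.sum_comp, Fintype.sum_prod_type]
  refine sum_congr rfl fun x _ => sum_congr rfl fun y _ => ?_
  simp [iid, pairLaw, prod_mul_distrib, Equiv.arrowProdEquivProdArrow]

theorem outProb2_augTester {n m : ℕ} (T τ : ℝ) (phat p q : Fin n → ℝ) (o : Outcome) :
    outProb2 p q (augTester (m := m) T τ phat) o
      = wmean (iid (pairLaw p q) m) fun f => wmean (iid (pairLaw p q) m) fun u =>
          wmean (iid (pairLaw p q) m) fun v =>
            if verdict T τ (flatWeight phat f) u v = o then 1 else 0 := by
  rw [outProb2_eq_wmean, wmean_iid_add]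
  simp only [wmean_iid_add, augTester, Fin.append_left, Fin.append_right]

theorem sum_augTester {n m : ℕ} (T τ : ℝ) (phat : Fin n → ℝ)
    (x y : Fin (m + (m + m)) → Fin n) : ∑ o, augTester T τ phat x y o = 1 := by
  simp [augTester]

theorem isAugClosenessTester_augTester {n m : ℕ} {α ε : ℝ} (hn : 0 < n) (hm : 0 < m)
    (hα₀ : 0 ≤ α) (hα : α ≤ 1) (hε : 0 < ε)
    (h₁ : 4000000 * n ≤ (m : ℝ) ^ 2)
    (h₂ : 2000 ^ 2 * (2 * (320 * (1 / n + α / m))) ≤ (m * (ε ^ 2 / n)) ^ 2)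
    (h₃ : 2000 ^ 2 ≤ (m : ℝ) ^ 2 * (ε ^ 2 / n)) :
    IsAugClosenessTester α ε 0.3
      (augTester (n := n) (m := m) (320 * (1 / n + α / m)) (ε ^ 2 / n / 2)) := by
  have hn' : (0 : ℝ) < n := by exact_mod_cast hn
  have hm' : (0 : ℝ) < m := by exact_mod_cast hm
  refine ⟨fun _ _ _ _ => by unfold augTester; positivity, sum_augTester _ _, ?_⟩
  intro phat p q hphat hp hq
  have hw := flatWeight_mem (m := m) hphat
  have hnorm : ∀ f : Fin m → Fin n × Fin n,
      1000 ≤ m * √(∑ a, flatWeight phat f a * p a ^ 2) := by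
    intro f
    have h := sq_sum_abs_le hm hphat f p
    simp only [abs_of_nonneg (hp.1 _), hp.2] at h
    set B := ∑ a, flatWeight phat f a * p a ^ 2
    have hB₀ : 0 < B := by
      by_contra hc
      nlinarith
    rw [← Real.sqrt_sq hm'.le, ← Real.sqrt_mul (by positivity)]
    apply Real.le_sqrt_of_sq_le
    nlinarith
  have hr := pairLaw_nonneg hp hq
  have hI := iid_nonneg hr m
  have hsum := sum_iid (sum_pairLaw hp hq) m
  simp only [outProb2_augTester]
  refine ⟨fun htv => ?_, fun hpq => ?_, fun htv => ?_⟩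
  · set T := 320 * (1 / n + α / m) with hT
    have hT₀ : 0 < T := by positivity
    have key : ∀ f : Fin m → Fin n × Fin n,
        (wmean (iid (pairLaw p q) m) fun u => wmean (iid (pairLaw p q) m) fun v =>
          if verdict T (ε ^ 2 / n / 2) (flatWeight phat f) u v = Outcome.inaccurate
            then 1 else 0)
        ≤ 2 / T * (∑ a, flatWeight phat f a * p a ^ 2) + 0.05 := by
      intro f
      have hB₀ : 0 ≤ ∑ a, flatWeight phat f a * p a ^ 2 :=
        sum_nonneg fun a _ => mul_nonneg (hw f a).1 (sq_nonneg _)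
      rcases le_total (2 * ∑ a, flatWeight phat f a * p a ^ 2) T with hB | hB
      · have := wmean_verdict_inaccurate_le (δ := ε ^ 2 / n / 2) hp hq (hw f) (hnorm f) hB
        have : 0 ≤ 2 / T * ∑ a, flatWeight phat f a * p a ^ 2 := by positivity
        linarith
      · have h : 1 ≤ 2 / T * ∑ a, flatWeight phat f a * p a ^ 2 := by
          rw [div_mul_eq_mul_div, one_le_div hT₀]
          exact hB
        have h' : (wmean (iid (pairLaw p q) m) fun u => wmean (iid (pairLaw p q) m) fun v =>
            if verdict T (ε ^ 2 / n / 2) (flatWeight phat f) u v = Outcome.inaccurate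
              then (1 : ℝ) else 0)
            ≤ wmean (iid (pairLaw p q) m) fun u => wmean (iid (pairLaw p q) m) fun v => 1 :=
          wmean_mono hI fun u => wmean_mono hI fun v => by split_ifs <;> norm_num
        rw [wmean_const hsum, wmean_const hsum] at h'
        linarith
    refine (wmean_mono hI key).trans ?_
    rw [wmean_add, wmean_mul_left, wmean_const hsum]
    have h := mul_le_mul_of_nonneg_left (wmean_flat_norm_le hn hm hp hq hphat hα htv)
      (by positivity : 0 ≤ 2 / T)
    have e : 2 / T * (8 * (1 / n + α / m)) = 0.05 := by
      rw [div_mul_eq_mul_div, div_eq_iff hT₀.ne', hT]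
      ring
    norm_num at h e ⊢
    linarith
  · subst hpq
    refine (wmean_mono hI fun f => wmean_verdict_reject_le hp (hw f) (hnorm f)
      (by positivity) h₂).trans ?_
    rw [wmean_const hsum]
    norm_num
  · refine (wmean_mono hI fun f => wmean_verdict_accept_le hp hq (hw f) (hnorm f)
      (by positivity) h₂ h₃ ?_).trans ?_
    · have h := sq_sum_abs_le hm hphat f fun a => p a - q a
      unfold tv at htv
      have h' : ε ^ 2 * 4 ≤ (∑ a, |p a - q a|) ^ 2 := by nlinarith
      rw [div_le_iff₀ hn']
      nlinarith
    · rw [wmean_const hsum]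
      norm_num

theorem sample_size_bounds {n : ℕ} (hn : 0 < n) {α ε m : ℝ} (hα : 0 < α) (hε : 0 < ε)
    (hε₁ : ε < 1)
    (hm : 100000 * ((n : ℝ) ^ ((2:ℝ)/3) * α ^ ((1:ℝ)/3) / ε ^ ((4:ℝ)/3)
      + Real.sqrt n / ε ^ 2) ≤ m) :
    4000000 * n ≤ m ^ 2 ∧
    2000 ^ 2 * (2 * (320 * (1 / n + α / m))) ≤ (m * (ε ^ 2 / n)) ^ 2 ∧
    2000 ^ 2 ≤ m ^ 2 * (ε ^ 2 / n) := by
  have hn' : (0 : ℝ) < n := by exact_mod_cast hn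
  set X := (n : ℝ) ^ ((2:ℝ)/3) * α ^ ((1:ℝ)/3) / ε ^ ((4:ℝ)/3) with hX
  set Y := Real.sqrt n / ε ^ 2 with hY
  have hX₀ : 0 < X := by positivity
  have hY₀ : 0 < Y := by positivity
  have hX3 : X ^ 3 = n ^ 2 * α / ε ^ 4 := by
    have e : ∀ x t : ℝ, 0 < x → (x ^ t) ^ 3 = x ^ (t * 3) := fun x t hx => by
      rw [Real.rpow_mul hx.le]
      norm_cast
    rw [hX, div_pow, mul_pow, e _ _ hn', e _ _ hα, e _ _ hε]
    norm_num
  have hY2 : Y ^ 2 = n / ε ^ 4 := by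
    rw [hY, div_pow, Real.sq_sqrt hn'.le]
    ring
  have hm₀ : 0 < m := by linarith
  have hmX : (100000 * X) ^ 3 ≤ m ^ 3 := by
    gcongr
    linarith
  have hmY : (100000 * Y) ^ 2 ≤ m ^ 2 := by
    gcongr
    linarith
  rw [mul_pow, hX3, ← mul_div_assoc, div_le_iff₀ (by positivity)] at hmX
  rw [mul_pow, hY2, ← mul_div_assoc, div_le_iff₀ (by positivity)] at hmY
  have hε2 : ε ^ 2 ≤ 1 := by nlinarith
  have hε4 : ε ^ 4 ≤ ε ^ 2 := by nlinarith [sq_nonneg ε]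
  have hmε : m ^ 2 * ε ^ 4 ≤ m ^ 2 * ε ^ 2 := by gcongr
  have hmε' : m ^ 2 * ε ^ 2 ≤ m ^ 2 := by nlinarith [sq_nonneg m]
  refine ⟨by linarith, ?_, ?_⟩
  · have h₁ : 1 / n ≤ (m * (ε ^ 2 / n)) ^ 2 / 100000 ^ 2 := by
      rw [le_div_iff₀ (by norm_num), mul_pow, div_pow, ← mul_div_assoc,
        div_mul_eq_mul_div, div_le_div_iff₀ hn' (by positivity)]
      nlinarith
    have h₂ : α / m ≤ (m * (ε ^ 2 / n)) ^ 2 / 100000 ^ 3 := by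
      rw [le_div_iff₀ (by norm_num), mul_pow, div_pow, ← mul_div_assoc,
        div_mul_eq_mul_div, div_le_div_iff₀ hm₀ (by positivity)]
      nlinarith
    have : 0 ≤ (m * (ε ^ 2 / n)) ^ 2 := sq_nonneg _
    linarith
  · rw [← mul_div_assoc, le_div_iff₀ hn']
    linarith

/-- upper bound for augmented closeness testing: there is an
absolute constant `C > 0` such that for every `n` and all `α, ε ∈ (0,1)` there is
an `(α, ε, 0.3)`-augmented closeness tester whose total number of samples (drawn
from `p` and `q` combined, here `2s`) is at most
`C·(n^{2/3}·α^{1/3}/ε^{4/3} + √n/ε²)`. -/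
theorem stmt6 :
    ∃ C : ℝ, 0 < C ∧
      ∀ (n : ℕ) (α ε : ℝ), α ∈ Set.Ioo (0:ℝ) 1 → ε ∈ Set.Ioo (0:ℝ) 1 →
        ∃ (s : ℕ)
          (A : (Fin n → ℝ) → (Fin s → Fin n) → (Fin s → Fin n) → Outcome → ℝ),
          IsAugClosenessTester α ε 0.3 A ∧
          (2 * s : ℝ) ≤ C * ((n : ℝ) ^ ((2:ℝ)/3) * α ^ ((1:ℝ)/3) / ε ^ ((4:ℝ)/3)
            + Real.sqrt n / ε ^ 2) := by
  refine ⟨600006, by norm_num, ?_⟩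
  rintro n α ε ⟨hα₀, hα₁⟩ ⟨hε₀, hε₁⟩
  rcases Nat.eq_zero_or_pos n with rfl | hn
  · refine ⟨0, fun _ _ _ o => if o = Outcome.accept then 1 else 0,
      ⟨fun _ _ _ _ => by positivity, fun _ _ _ => by simp, ?_⟩, by simp⟩
    intro phat p q h _ _
    have := h.2
    simp at this
  set R := (n : ℝ) ^ ((2:ℝ)/3) * α ^ ((1:ℝ)/3) / ε ^ ((4:ℝ)/3) + Real.sqrt n / ε ^ 2
  have hR₁ : 1 ≤ R := by
    have h₁ : 0 ≤ (n : ℝ) ^ ((2:ℝ)/3) * α ^ ((1:ℝ)/3) / ε ^ ((4:ℝ)/3) := by positivity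
    have h₂ : 1 ≤ Real.sqrt n / ε ^ 2 := by
      rw [one_le_div (by positivity)]
      have : 1 ≤ Real.sqrt n := Real.one_le_sqrt.2 (by exact_mod_cast hn)
      nlinarith
    linarith
  have hle := Nat.le_ceil (100000 * R)
  have hlt := Nat.ceil_lt_add_one (by positivity : 0 ≤ 100000 * R)
  have hm : 0 < ⌈100000 * R⌉₊ := Nat.ceil_pos.2 (by positivity)
  obtain ⟨h₁, h₂, h₃⟩ := sample_size_bounds hn hα₀ hε₀ hε₁ hle
  refine ⟨_, _, isAugClosenessTester_augTester hn hm hα₀.le hα₁.le hε₀ h₁ h₂ h₃, ?_⟩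
  push_cast
  linarith
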